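/- For every y ∈ E and every bounded measurable z : [t₀,T] → E, there exists a unique mild solution with data (y,z): a unique bounded measurable Y : [t₀,T] → E satisfying Y(t) = S(t−t₀)y + ∫_{t₀}^t S(t−s)B(s,Y(s)) ds + z(t) for every t ∈ [t₀,T]. -/

import Mathlib

open MeasureTheory

variable {E : Type*} [NormedAddCommGroup E] [NormedSpace ℝ E]

/-- A function `[t₀,T] → E` which is measurable and bounded. -/
def BddMeasOn [MeasurableSpace E] (f : ℝ → E) (t₀ T : ℝ) : Prop :=
  Measurable (fun t : Set.Icc t₀ T => f t) ∧ ∃ M, ∀ t ∈ Set.Icc t₀ T, ‖f t‖ ≤ M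

/-- `Y` is a mild solution on `[t₀,T]` of `dY = AY dt + B(t,Y) dt + dz`, i.e.
`Y(t) = S(t-t₀) y + ∫_{t₀}^t S(t-s) B(s,Y(s)) ds + z(t)` for all `t ∈ [t₀,T]`. -/
def IsMildSolution (S : ℝ → E →L[ℝ] E) (B : ℝ → E → E) (t₀ T : ℝ)
    (y : E) (z : ℝ → E) (Y : ℝ → E) : Prop :=
  ∀ t ∈ Set.Icc t₀ T,
    Y t = S (t - t₀) y + (∫ s in t₀..t, S (t - s) (B s (Y s))) + z t

section BorelMaps

open Set Function Filter TopologicalSpace Topology Cardinal CantorScheme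
open scoped ENNReal

/-- A nonempty closed set no nonempty relatively open piece of which is collapsed to a point
by `h`. -/
def PerfectFor {P X : Type*} [TopologicalSpace P] (h : P → X) (C : Set P) : Prop :=
  IsClosed C ∧ C.Nonempty ∧
    ∀ O : Set P, IsOpen O → (O ∩ C).Nonempty → ¬ (h '' (O ∩ C)).Subsingleton

theorem PerfectFor.closure_inter {P X : Type*} [TopologicalSpace P] {h : P → X} {C O : Set P}
    (hC : PerfectFor h C) (hO : IsOpen O) (hne : (O ∩ C).Nonempty) :
    PerfectFor h (closure (O ∩ C)) := by
  refine ⟨isClosed_closure, hne.closure, fun W hW hWne hsub => ?_⟩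
  obtain ⟨x, hxW, hx⟩ := hWne
  have hne' : (W ∩ (O ∩ C)).Nonempty := mem_closure_iff.1 hx W hW hxW
  refine hC.2.2 (W ∩ O) (hW.inter hO) (by rwa [inter_assoc]) (hsub.anti (image_mono ?_))
  rw [inter_assoc]
  exact inter_subset_inter_right _ subset_closure

theorem PerfectFor.splitting {P X : Type*} [MetricSpace P] [TopologicalSpace X] [T25Space X]
    {h : P → X} (hh : Continuous h) {C : Set P} (hC : PerfectFor h C) {ε : ℝ≥0∞} (hε : 0 < ε) :
    ∃ C₀ C₁ : Set P, (PerfectFor h C₀ ∧ C₀ ⊆ C ∧ Metric.ediam C₀ ≤ ε) ∧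
      (PerfectFor h C₁ ∧ C₁ ⊆ C ∧ Metric.ediam C₁ ≤ ε) ∧ Disjoint (h '' C₀) (h '' C₁) := by
  have hns := hC.2.2 univ isOpen_univ (by simpa using hC.2.1)
  rw [univ_inter, Set.not_subsingleton_iff] at hns
  obtain ⟨_, ⟨x₀, hx₀, rfl⟩, _, ⟨x₁, hx₁, rfl⟩, hne⟩ := hns
  obtain ⟨U, hxU, hU, V, hxV, hV, hUV⟩ := exists_open_nhds_disjoint_closure hne
  have piece : ∀ (x : P) (W : Set X), x ∈ C → h x ∈ W → IsOpen W →
      ∃ D : Set P, (PerfectFor h D ∧ D ⊆ C ∧ Metric.ediam D ≤ ε) ∧ h '' D ⊆ closure W := by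
    intro x W hx hxW hW
    have hpos : 0 < ε / 2 := ENNReal.div_pos hε.ne' (by simp)
    refine ⟨closure (Metric.eball x (ε / 2) ∩ h ⁻¹' W ∩ C), ⟨hC.closure_inter
      (Metric.isOpen_eball.inter (hW.preimage hh)) ⟨x, ⟨Metric.mem_eball_self hpos, hxW⟩, hx⟩,
      ?_, ?_⟩, ?_⟩
    · exact hC.1.closure_subset_iff.2 inter_subset_right
    · rw [Metric.ediam_closure]
      refine (Metric.ediam_mono (inter_subset_left.trans inter_subset_left)).trans ?_
      refine Metric.ediam_eball_le.trans ?_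
      rw [ENNReal.mul_div_cancel (by simp) (by simp)]
    · refine (image_closure_subset_closure_image hh).trans (closure_mono ?_)
      rintro _ ⟨p, hp, rfl⟩
      exact hp.1.2
  obtain ⟨D₀, hD₀, h₀⟩ := piece x₀ U hx₀ hxU hU
  obtain ⟨D₁, hD₁, h₁⟩ := piece x₁ V hx₁ hxV hV
  exact ⟨D₀, D₁, hD₀, hD₁, hUV.mono h₀ h₁⟩

theorem exists_perfectFor_of_not_countable_range {P X : Type*} [TopologicalSpace P]
    [SecondCountableTopology P] {h : P → X} (hunc : ¬ (range h).Countable) :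
    ∃ C, PerfectFor h C := by
  set b := {V ∈ countableBasis P | (h '' V).Countable} with hb
  have hbc : b.Countable := (countable_countableBasis P).mono (sep_subset _ _)
  have hUc : (h '' ⋃₀ b).Countable := by
    rw [sUnion_eq_biUnion, image_iUnion₂]
    exact hbc.biUnion fun V hV => hV.2
  have hUo : IsOpen (⋃₀ b) :=
    isOpen_sUnion fun V hV => isOpen_of_mem_countableBasis hV.1
  refine ⟨(⋃₀ b)ᶜ, hUo.isClosed_compl, ?_, ?_⟩
  · rw [nonempty_compl]
    intro heq
    rw [heq, image_univ] at hUc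
    exact hunc hUc
  · rintro O hO ⟨x, hxO, hxC⟩ hsub
    obtain ⟨V, hV, hxV, hVO⟩ := (isBasis_countableBasis P).exists_subset_of_mem_open hxO hO
    refine hxC (mem_sUnion_of_mem hxV ⟨hV, ?_⟩)
    refine (hsub.countable.union hUc).mono ?_
    rw [← image_union]
    refine image_mono fun p hp => ?_
    by_cases hpU : p ∈ ⋃₀ b
    · exact Or.inr hpU
    · exact Or.inl ⟨hVO hp, hpU⟩

/-- The perfect set property for continuous images of Polish spaces. -/
theorem Continuous.exists_injective_comp_of_not_countable_range {P X : Type*}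
    [TopologicalSpace P] [PolishSpace P] [TopologicalSpace X] [T25Space X] {h : P → X}
    (hh : Continuous h) (hunc : ¬ (range h).Countable) :
    ∃ g : (ℕ → Bool) → P, Injective (h ∘ g) := by
  let := upgradeIsCompletelyMetrizable P
  obtain ⟨C, hC⟩ := exists_perfectFor_of_not_countable_range hunc
  obtain ⟨u, -, upos', hu⟩ := exists_seq_strictAnti_tendsto' (zero_lt_one' ℝ≥0∞)
  have upos := fun n => (upos' n).1
  choose C0 C1 h0 h1 hdisj using
    fun {C : Set P} (hC : PerfectFor h C) {ε : ℝ≥0∞} (hε : 0 < ε) => hC.splitting hh hε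
  let DP : List Bool → {D : Set P // PerfectFor h D} := fun l => by
    induction l with
    | nil => exact ⟨C, hC⟩
    | cons a l ih =>
      cases a
      · exact ⟨C0 ih.2 (upos (l.length + 1)), (h0 _ _).1⟩
      · exact ⟨C1 ih.2 (upos (l.length + 1)), (h1 _ _).1⟩
  let D : List Bool → Set P := fun l => (DP l).val
  have hanti : ClosureAntitone D := by
    refine Antitone.closureAntitone ?_ fun l => (DP l).2.1
    intro l a
    cases a
    · exact (h0 _ _).2.1
    · exact (h1 _ _).2.1
  have hdiam : VanishingDiam D := by
    intro x
    apply tendsto_of_tendsto_of_tendsto_of_le_of_le' tendsto_const_nhds hu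
    · simp
    rw [eventually_atTop]
    refine ⟨1, fun m hm => ?_⟩
    obtain ⟨n, rfl⟩ := Nat.exists_eq_succ_of_ne_zero (Nat.one_le_iff_ne_zero.1 hm)
    dsimp
    cases x n
    · convert! (h0 _ _).2.2
      rw [PiNat.res_length]
    · convert! (h1 _ _).2.2
      rw [PiNat.res_length]
  have hdom : ∀ x : ℕ → Bool, x ∈ (inducedMap D).1 := fun x => by
    rw [hanti.map_of_vanishingDiam hdiam fun l => (DP l).2.2.1]
    apply mem_univ
  refine ⟨fun x => (inducedMap D).2 ⟨x, hdom x⟩, fun x y hxy => ?_⟩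
  set p : (ℕ → Bool) → P := fun x => (inducedMap D).2 ⟨x, hdom x⟩
  have hp : ∀ x n, p x ∈ D (PiNat.res x n) := fun x n => map_mem ⟨x, hdom x⟩ n
  let D' : List Bool → Set X := fun l => h '' D l ∩ {h (p x)}
  have hdisj' : CantorScheme.Disjoint D' := by
    have key : ∀ l, Disjoint (h '' D (false :: l)) (h '' D (true :: l)) :=
      fun l => hdisj (DP l).2 _
    rintro l (a | a) (b | b) hab <;> try contradiction
    · exact (key l).mono inter_subset_left inter_subset_left
    · exact (key l).symm.mono inter_subset_left inter_subset_left
  have hx : x ∈ (inducedMap D').1 :=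
    ⟨h (p x), mem_iInter.2 fun n => ⟨mem_image_of_mem h (hp x n), rfl⟩⟩
  have hy : y ∈ (inducedMap D').1 :=
    ⟨h (p x), mem_iInter.2 fun n => ⟨⟨p y, hp y n, hxy.symm⟩, rfl⟩⟩
  have heq : (inducedMap D').2 ⟨x, hx⟩ = (inducedMap D').2 ⟨y, hy⟩ :=
    (map_mem ⟨x, hx⟩ 0).2.trans (map_mem ⟨y, hy⟩ 0).2.symm
  exact congrArg Subtype.val (hdisj'.map_injective heq)

/-- A map on a standard Borel space all of whose preimages are measurable has countable range. -/
theorem countable_range_of_forall_measurableSet_preimage {X A : Type*} [MeasurableSpace X]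
    [StandardBorelSpace X] (f : X → A) (hf : ∀ s : Set A, MeasurableSet (f ⁻¹' s)) :
    (range f).Countable := by
  rcases isEmpty_or_nonempty X with hX | hX
  · simp [range_eq_empty]
  by_contra hunc
  obtain ⟨e, he⟩ := exists_measurableEmbedding_real X
  let g : X → ℝ := fun x => e (invFun f (f x))
  have hfinv : ∀ x, f (invFun f (f x)) = f x := fun x => invFun_eq ⟨x, rfl⟩
  have hg : Measurable g := fun t _ => hf ((fun a => e (invFun f a)) ⁻¹' t)
  have hgunc : ¬ (range g).Countable := by
    intro hc
    refine hunc ((hc.image (f ∘ invFun e)).mono ?_)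
    rintro _ ⟨x, rfl⟩
    exact ⟨g x, ⟨x, rfl⟩, by simp [g, leftInverse_invFun he.injective _, hfinv]⟩
  obtain ⟨φ, hφ⟩ : ∃ φ : (ℕ → Bool) → X, Injective (f ∘ φ) := by
    let := upgradeStandardBorel X
    obtain ⟨t', -, hcont, hpol⟩ := hg.exists_continuous
    obtain ⟨φ, hφ⟩ := @Continuous.exists_injective_comp_of_not_countable_range
      X ℝ t' hpol _ _ g hcont hgunc
    exact ⟨φ, fun x y hxy => hφ (congrArg (fun a => e (invFun f a)) hxy)⟩
  let Φ : Set (ℕ → Bool) → {t : Set X | MeasurableSet t} := fun s =>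
    ⟨f ⁻¹' ((f ∘ φ) '' s), hf _⟩
  have hΦ : Injective Φ := by
    intro s t hst
    have h1 : φ ⁻¹' (f ⁻¹' ((f ∘ φ) '' s)) = φ ⁻¹' (f ⁻¹' ((f ∘ φ) '' t)) :=
      congrArg (φ ⁻¹' ·) (congrArg Subtype.val hst)
    rwa [← preimage_comp, ← preimage_comp, preimage_image_eq _ hφ, preimage_image_eq _ hφ] at h1
  have hcard : #{t : Set X | MeasurableSet t} ≤ 𝔠 := by
    obtain ⟨b, hbc, hb⟩ := MeasurableSpace.CountablyGenerated.isCountablyGenerated (α := X)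
    rw [hb]
    exact MeasurableSpace.cardinal_measurableSet_le_continuum
      (hbc.le_aleph0.trans aleph0_le_continuum)
  have hle := lift_mk_le_lift_mk_of_injective hΦ
  have : 2 ^ 𝔠 ≤ 𝔠 := by
    have h2 := hle.trans (lift_le.2 hcard)
    simpa using h2
  exact (cantor 𝔠).not_ge this

/-- A Borel map from a standard Borel space to a metric space has separable range. -/
theorem Measurable.isSeparable_range_of_standardBorelSpace {X Y : Type*} [MeasurableSpace X]
    [StandardBorelSpace X] [MetricSpace Y] [MeasurableSpace Y] [OpensMeasurableSpace Y]
    {f : X → Y} (hf : Measurable f) : IsSeparable (range f) := by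
  have hmax : ∀ ε : ℝ, ∃ N, Maximal (fun N ↦ N ⊆ range f ∧ N.Pairwise (ε ≤ Dist.dist · ·)) N := by
    intro ε
    refine zorn_subset {N | N ⊆ range f ∧ N.Pairwise (ε ≤ Dist.dist · ·)} fun c hc hchain =>
      ⟨⋃₀ c, ⟨sUnion_subset fun N hN => (hc hN).1, ?_⟩, fun N hN => subset_sUnion_of_mem hN⟩
    exact (pairwise_sUnion hchain.directedOn).2 fun N hN => (hc hN).2
  choose N hN using hmax
  have hcount : ∀ ε, 0 < ε → (N ε).Countable := by
    intro ε hε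
    have hclosed : ∀ s ⊆ N ε, IsClosed s := fun s hs =>
      Metric.isClosed_of_pairwise_le_dist hε ((hN ε).prop.2.mono hs)
    have hmeas : MeasurableSet (f ⁻¹' N ε) := hf (hclosed _ subset_rfl).measurableSet
    have := hmeas.standardBorel
    let F : f ⁻¹' N ε → Y := fun x => f x
    have hF : range F = N ε := by
      ext y
      constructor
      · rintro ⟨x, rfl⟩
        exact x.2
      · intro hy
        obtain ⟨x, rfl⟩ := (hN ε).prop.1 hy
        exact ⟨⟨x, hy⟩, rfl⟩
    rw [← hF]
    refine countable_range_of_forall_measurableSet_preimage F fun s => ?_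
    have : F ⁻¹' s = F ⁻¹' (s ∩ N ε) := by
      ext x
      exact ⟨fun h => ⟨h, x.2⟩, fun h => h.1⟩
    rw [this]
    exact (hf.comp measurable_subtype_coe) (hclosed _ inter_subset_right).measurableSet
  refine ⟨⋃ n : ℕ, N (1 / (n + 1)),
    countable_iUnion fun n => hcount _ Nat.one_div_pos_of_nat, fun y hy => ?_⟩
  rw [Metric.mem_closure_iff]
  intro ε hε
  obtain ⟨n, hn⟩ := exists_nat_one_div_lt hε
  by_contra! hfar
  have hfar' : ∀ b ∈ N (1 / ((n : ℝ) + 1)), 1 / ((n : ℝ) + 1) ≤ Dist.dist y b := fun b hb =>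
    hn.le.trans (hfar b (mem_iUnion_of_mem n hb))
  have hmem : y ∈ N (1 / ((n : ℝ) + 1)) := by
    refine (hN _).le_of_ge ⟨insert_subset hy (hN _).prop.1, ?_⟩ (subset_insert y _)
      (mem_insert y _)
    exact pairwise_insert.2 ⟨(hN _).prop.2, fun b hb _ =>
      ⟨hfar' b hb, (hfar' b hb).trans_eq (_root_.dist_comm y b)⟩⟩
  have := hfar' y hmem
  rw [dist_self] at this
  exact this.not_gt Nat.one_div_pos_of_nat

/-- A Borel map from a standard Borel space to a metric space is strongly measurable, without any
separability assumption on the target. -/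
theorem Measurable.stronglyMeasurable_of_standardBorelSpace {X Y : Type*} [MeasurableSpace X]
    [StandardBorelSpace X] [MetricSpace Y] [MeasurableSpace Y] [BorelSpace Y]
    {f : X → Y} (hf : Measurable f) : StronglyMeasurable f :=
  stronglyMeasurable_iff_measurable_separable.2
    ⟨hf, hf.isSeparable_range_of_standardBorelSpace⟩

end BorelMaps

section Volterra

open Set Filter Topology

variable {F : Type*} [NormedAddCommGroup F]

theorem MeasureTheory.StronglyMeasurable.intervalIntegral_prod_right [NormedSpace ℝ F]
    {g : ℝ → ℝ → F} (hg : StronglyMeasurable (Function.uncurry g)) (a : ℝ) :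
    StronglyMeasurable fun t => ∫ s in a..t, g t s := by
  have key : ∀ A : Set (ℝ × ℝ), MeasurableSet A →
      StronglyMeasurable fun t => ∫ s in {s | (t, s) ∈ A}, g t s := by
    intro A hA
    have h := (hg.indicator hA).integral_prod_right' (ν := (volume : Measure ℝ))
    convert! h using 2 with t
    exact (integral_indicator (measurable_prodMk_left hA)).symm
  simp only [intervalIntegral]
  refine (key {p | p.2 ∈ Ioc a p.1} ?_).sub (key {p | p.2 ∈ Ioc p.1 a} ?_)
  · exact (_root_.measurableSet_lt measurable_const measurable_snd).inter
      (_root_.measurableSet_le measurable_snd measurable_fst)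
  · exact (_root_.measurableSet_lt measurable_fst measurable_snd).inter
      (_root_.measurableSet_le measurable_snd measurable_const)

/-- A measurable family of integrands `f t s x`, uniformly bounded by `Q` and uniformly Lipschitz
in `x` with constant `L` for `a ≤ s ≤ t ≤ b`. -/
structure IsVolterraKernel [MeasurableSpace F] (f : ℝ → ℝ → F → F) (a b Q L : ℝ) : Prop where
  measurable : Measurable fun p : (ℝ × ℝ) × F => f p.1.1 p.1.2 p.2
  norm_le : ∀ ⦃t s⦄, a ≤ s → s ≤ t → t ≤ b → ∀ x, ‖f t s x‖ ≤ Q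
  norm_sub_le : ∀ ⦃t s⦄, a ≤ s → s ≤ t → t ≤ b → ∀ x x', ‖f t s x - f t s x'‖ ≤ L * ‖x - x'‖
  nonneg : 0 ≤ L

namespace IsVolterraKernel

variable [MeasurableSpace F] {f : ℝ → ℝ → F → F} {a b Q L : ℝ}

theorem stronglyMeasurable [BorelSpace F] (hf : IsVolterraKernel f a b Q L) {U : ℝ → F}
    (hU : Measurable U) :
    StronglyMeasurable (Function.uncurry fun t s => f t s (U s)) :=
  (hf.measurable.comp
    (measurable_id.prodMk (hU.comp measurable_snd))).stronglyMeasurable_of_standardBorelSpace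

theorem intervalIntegrable [BorelSpace F] (hf : IsVolterraKernel f a b Q L) {U : ℝ → F}
    (hU : Measurable U) {t : ℝ} (ht : t ∈ Icc a b) :
    IntervalIntegrable (fun s => f t s (U s)) volume a t := by
  have hm : StronglyMeasurable fun s => f t s (U s) :=
    (hf.stronglyMeasurable hU).comp_measurable measurable_prodMk_left
  rw [intervalIntegrable_iff_integrableOn_Ioc_of_le ht.1]
  refine Measure.integrableOn_of_bounded (M := Q) (by simp) hm.aestronglyMeasurable ?_
  filter_upwards [ae_restrict_mem measurableSet_Ioc] with s hs
  exact hf.norm_le hs.1.le hs.2 ht.2 _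

variable [NormedSpace ℝ F]

theorem norm_integral_le (hf : IsVolterraKernel f a b Q L) (U : ℝ → F) {t : ℝ}
    (ht : t ∈ Icc a b) : ‖∫ s in a..t, f t s (U s)‖ ≤ Q * (b - a) := by
  have hQ : 0 ≤ Q := (norm_nonneg _).trans (hf.norm_le ht.1 le_rfl ht.2 0)
  refine (intervalIntegral.norm_integral_le_of_norm_le_const (C := Q) fun s hs => ?_).trans ?_
  · rw [uIoc_of_le ht.1] at hs
    exact hf.norm_le hs.1.le hs.2 ht.2 _
  · rw [abs_of_nonneg (sub_nonneg.2 ht.1)]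
    gcongr
    exact ht.2

variable [BorelSpace F]

/-- The Volterra operator halves distances in the exponentially weighted sup norm. -/
theorem norm_integral_sub_le (hf : IsVolterraKernel f a b Q L) {U V : ℝ → F}
    (hU : Measurable U) (hV : Measurable V) {D : ℝ} (hD : 0 ≤ D)
    (hUV : ∀ s ∈ Icc a b, ‖U s - V s‖ ≤ D * Real.exp ((2 * L + 1) * (s - a)))
    {t : ℝ} (ht : t ∈ Icc a b) :
    ‖(∫ s in a..t, f t s (U s)) - ∫ s in a..t, f t s (V s)‖ ≤
      D / 2 * Real.exp ((2 * L + 1) * (t - a)) := by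
  have hL := hf.nonneg
  set l := 2 * L + 1 with hl
  have hl0 : 0 < l := by positivity
  rw [← intervalIntegral.integral_sub (hf.intervalIntegrable hU ht) (hf.intervalIntegrable hV ht)]
  have hint : ∫ s in a..t, L * (D * Real.exp (l * (s - a))) =
      L * D / l * Real.exp (l * (t - a)) - L * D / l * Real.exp (l * (a - a)) := by
    refine intervalIntegral.integral_eq_sub_of_hasDerivAt
      (f := fun s => L * D / l * Real.exp (l * (s - a))) (fun s _ => ?_)
      (Continuous.intervalIntegrable (by fun_prop) _ _)
    have h := (((hasDerivAt_id s).sub_const a).const_mul l).exp.const_mul (L * D / l)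
    convert! h using 1
    simp only [id]
    field_simp
  refine (intervalIntegral.norm_integral_le_of_norm_le ht.1 ?_
    (Continuous.intervalIntegrable (by fun_prop) _ _)).trans (hint.le.trans ?_)
  · refine ae_of_all _ fun s hs => (hf.norm_sub_le hs.1.le hs.2 ht.2 _ _).trans ?_
    gcongr
    exact hUV s ⟨hs.1.le, hs.2.trans ht.2⟩
  · have h1 : L * D / l ≤ D / 2 := by
      rw [div_le_div_iff₀ hl0 two_pos, hl]
      nlinarith
    have h2 : 0 ≤ L * D / l * Real.exp (l * (a - a)) := by positivity
    have h3 := mul_le_mul_of_nonneg_right h1 (Real.exp_pos (l * (t - a))).le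
    linarith

/-- Uniqueness for Volterra equations. -/
theorem eqOn_of_eq (hf : IsVolterraKernel f a b Q L) {w U V : ℝ → F}
    (hU : Measurable U) (hV : Measurable V)
    (hUeq : ∀ t ∈ Icc a b, U t = w t + ∫ s in a..t, f t s (U s))
    (hVeq : ∀ t ∈ Icc a b, V t = w t + ∫ s in a..t, f t s (V s)) : EqOn U V (Icc a b) := by
  intro t ht
  have hab : a ≤ b := ht.1.trans ht.2
  have hL := hf.nonneg
  have hsub : ∀ s ∈ Icc a b,
      U s - V s = (∫ r in a..s, f s r (U r)) - ∫ r in a..s, f s r (V r) := fun s hs => by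
    rw [hUeq s hs, hVeq s hs, add_sub_add_left_eq_sub]
  have hQ : 0 ≤ Q := (norm_nonneg _).trans (hf.norm_le le_rfl hab le_rfl 0)
  set D := Q * (b - a) + Q * (b - a) with hD
  have hD0 : 0 ≤ D := by
    have := mul_nonneg hQ (sub_nonneg.2 hab)
    linarith
  have key : ∀ n : ℕ, ∀ s ∈ Icc a b,
      ‖U s - V s‖ ≤ D / 2 ^ n * Real.exp ((2 * L + 1) * (s - a)) := by
    intro n
    induction n with
    | zero =>
      intro s hs
      have h1 : 1 ≤ Real.exp ((2 * L + 1) * (s - a)) :=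
        Real.one_le_exp (mul_nonneg (by positivity) (sub_nonneg.2 hs.1))
      rw [pow_zero, div_one, hsub s hs]
      exact (norm_sub_le_of_le (hf.norm_integral_le U hs) (hf.norm_integral_le V hs)).trans
        (le_mul_of_one_le_right hD0 h1)
    | succ n ih =>
      intro s hs
      rw [hsub s hs, pow_succ, ← div_div]
      exact hf.norm_integral_sub_le hU hV (by positivity) ih hs
  have hlim : Tendsto (fun n : ℕ => D / 2 ^ n * Real.exp ((2 * L + 1) * (t - a))) atTop
      (𝓝 0) := by
    have h := (tendsto_const_nhds (x := D)).div_atTop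
      (tendsto_pow_atTop_atTop_of_one_lt (one_lt_two (α := ℝ)))
    simpa using h.mul_const (Real.exp ((2 * L + 1) * (t - a)))
  have := ge_of_tendsto' hlim fun n => key n t ht
  exact sub_eq_zero.1 (norm_le_zero_iff.1 this)

/-- Existence for Volterra equations, by Picard iteration. -/
theorem exists_eq [CompleteSpace F] (hf : IsVolterraKernel f a b Q L) (hab : a ≤ b) {w : ℝ → F}
    (hw : StronglyMeasurable w) {R : ℝ} (hwR : ∀ t ∈ Icc a b, ‖w t‖ ≤ R) :
    ∃ U : ℝ → F, Measurable U ∧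
      ∀ t ∈ Icc a b, U t = w t + ∫ s in a..t, f t s (U s) := by
  have hL := hf.nonneg
  set e : ℝ → ℝ := fun t => Real.exp ((2 * L + 1) * (t - a)) with he
  let Y : ℕ → ℝ → F := fun n =>
    Nat.rec (fun _ => 0) (fun _ U t => w t + ∫ s in a..t, f t s (U s)) n
  have hY : ∀ n t, Y (n + 1) t = w t + ∫ s in a..t, f t s (Y n s) := fun n t => rfl
  have hYm : ∀ n, StronglyMeasurable (Y n) := by
    intro n
    induction n with
    | zero => exact stronglyMeasurable_const
    | succ n ih =>
      exact hw.add ((hf.stronglyMeasurable ih.measurable).intervalIntegral_prod_right a)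
  set M := R + Q * (b - a) with hM
  have hM0 : 0 ≤ M := by
    have ha : a ∈ Icc a b := left_mem_Icc.2 hab
    exact add_nonneg ((norm_nonneg _).trans (hwR a ha))
      ((norm_nonneg _).trans (hf.norm_integral_le (Y 0) ha))
  have hstep : ∀ n : ℕ, ∀ t ∈ Icc a b, ‖Y n t - Y (n + 1) t‖ ≤ M / 2 ^ n * e t := by
    intro n
    induction n with
    | zero =>
      intro t ht
      have h1 : 1 ≤ e t := Real.one_le_exp (mul_nonneg (by positivity) (sub_nonneg.2 ht.1))
      rw [hY, pow_zero, div_one]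
      have : ‖Y 0 t - (w t + ∫ s in a..t, f t s (Y 0 s))‖ ≤ M := by
        rw [show Y 0 t = 0 from rfl, zero_sub, norm_neg]
        exact norm_add_le_of_le (hwR t ht) (hf.norm_integral_le _ ht)
      exact this.trans (le_mul_of_one_le_right hM0 h1)
    | succ n ih =>
      intro t ht
      rw [hY n, hY (n + 1), add_sub_add_left_eq_sub, pow_succ, ← div_div]
      exact hf.norm_integral_sub_le (hYm n).measurable (hYm (n + 1)).measurable
        (D := M / 2 ^ n) (by positivity) ih ht
  have hgeom : ∀ t ∈ Icc a b, ∀ n, dist (Y n t) (Y (n + 1) t) ≤ 2 * M * e t / 2 / 2 ^ n := by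
    intro t ht n
    rw [dist_eq_norm]
    exact (hstep n t ht).trans_eq (by ring)
  have hconv : ∀ t : ℝ, ∃ u, Tendsto (fun n => Y n (projIcc a b hab t)) atTop (𝓝 u) :=
    fun t => cauchySeq_tendsto_of_complete
      (cauchySeq_of_le_geometric_two (hgeom _ (projIcc a b hab t).2))
  choose U hUlim using hconv
  have hUlim' : ∀ t ∈ Icc a b, Tendsto (fun n => Y n t) atTop (𝓝 (U t)) := by
    intro t ht
    have := hUlim t
    rwa [projIcc_of_mem hab ht] at this
  have hproj : Measurable fun t : ℝ => (projIcc a b hab t : ℝ) :=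
    (continuous_subtype_val.comp continuous_projIcc).measurable
  have hUm : Measurable U := (stronglyMeasurable_of_tendsto atTop
    (fun n => (hYm n).comp_measurable hproj) (tendsto_pi_nhds.2 hUlim)).measurable
  refine ⟨U, hUm, fun t ht => ?_⟩
  have hdist : ∀ n : ℕ, ∀ s ∈ Icc a b, ‖Y n s - U s‖ ≤ 2 * M / 2 ^ n * e s := by
    intro n s hs
    rw [← dist_eq_norm]
    exact (dist_le_of_le_geometric_two_of_tendsto (hgeom s hs) (hUlim' s hs) n).trans_eq (by ring)
  refine tendsto_nhds_unique ((tendsto_add_atTop_iff_nat 1).2 (hUlim' t ht)) ?_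
  rw [tendsto_iff_norm_sub_tendsto_zero]
  have hlim : Tendsto (fun n : ℕ => 2 * M / 2 ^ n / 2 * e t) atTop (𝓝 0) := by
    have h := (tendsto_const_nhds (x := 2 * M)).div_atTop
      (tendsto_pow_atTop_atTop_of_one_lt (one_lt_two (α := ℝ)))
    simpa using (h.div_const 2).mul_const (e t)
  refine squeeze_zero (fun _ => norm_nonneg _) (fun n => ?_) hlim
  rw [hY, add_sub_add_left_eq_sub]
  exact hf.norm_integral_sub_le (hYm n).measurable hUm (by positivity) (hdist n) ht

end IsVolterraKernel

end Volterra

/-- For every `y ∈ E` and every bounded measurable `z : [t₀,T] → E`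
there exists a unique bounded measurable mild solution with data `(y,z)`. -/
theorem exists_unique_mild_solution
    {E : Type*} [NormedAddCommGroup E] [NormedSpace ℝ E] [CompleteSpace E]
    [MeasurableSpace E] [BorelSpace E]
    (T t₀ : ℝ) (hT : 0 < T) (ht₀ : t₀ ∈ Set.Ico (0:ℝ) T)
    (S : ℝ → E →L[ℝ] E) (C_A : ℝ)
    (hS0 : S 0 = ContinuousLinearMap.id ℝ E)
    (hSsemi : ∀ s t : ℝ, 0 ≤ s → 0 ≤ t → s + t ≤ T → (S t).comp (S s) = S (s + t))
    (hSbd : ∀ t ∈ Set.Icc (0:ℝ) T, ‖S t‖ ≤ C_A)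
    (hSmeas : Measurable fun p : ℝ × E => S p.1 p.2)
    (B : ℝ → E → E) (Bsup K_B : ℝ)
    (hBmeas : Measurable (Function.uncurry B))
    (hBbd : ∀ t x, ‖B t x‖ ≤ Bsup)
    (hBlip : ∀ t x x', ‖B t x - B t x'‖ ≤ K_B * ‖x - x'‖)
    (y : E) (z : ℝ → E) (hz : BddMeasOn z t₀ T) :
    (∃ Y : ℝ → E, BddMeasOn Y t₀ T ∧ IsMildSolution S B t₀ T y z Y) ∧
    (∀ Y₁ Y₂ : ℝ → E,
      BddMeasOn Y₁ t₀ T → IsMildSolution S B t₀ T y z Y₁ →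
      BddMeasOn Y₂ t₀ T → IsMildSolution S B t₀ T y z Y₂ →
      Set.EqOn Y₁ Y₂ (Set.Icc t₀ T)) := by
  have hTt : t₀ ≤ T := ht₀.2.le
  have hC0 : 0 ≤ C_A := (norm_nonneg _).trans (hSbd 0 ⟨le_rfl, hT.le⟩)
  have hSle : ∀ r ∈ Set.Icc (0 : ℝ) T, ∀ x, ‖S r x‖ ≤ C_A * ‖x‖ :=
    fun r hr x => (S r).le_of_opNorm_le (hSbd r hr) x
  have hmem : ∀ {t s : ℝ}, t₀ ≤ s → s ≤ t → t ≤ T → t - s ∈ Set.Icc (0 : ℝ) T :=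
    fun h₁ h₂ h₃ => ⟨sub_nonneg.2 h₂, by linarith [ht₀.1]⟩
  have hf : IsVolterraKernel (fun t s x => S (t - s) (B s x)) t₀ T (C_A * Bsup)
      (C_A * max K_B 0) :=
    { measurable := hSmeas.comp
        ((measurable_fst.fst.sub measurable_fst.snd).prodMk
          (hBmeas.comp (measurable_fst.snd.prodMk measurable_snd)))
      norm_le := fun t s h₁ h₂ h₃ x => (hSle _ (hmem h₁ h₂ h₃) _).trans
        (mul_le_mul_of_nonneg_left (hBbd s x) hC0)
      norm_sub_le := fun t s h₁ h₂ h₃ x x' => by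
        rw [← map_sub, mul_assoc]
        refine (hSle _ (hmem h₁ h₂ h₃) _).trans (mul_le_mul_of_nonneg_left ?_ hC0)
        exact (hBlip s x x').trans
          (mul_le_mul_of_nonneg_right (le_max_left _ _) (norm_nonneg _))
      nonneg := mul_nonneg hC0 (le_max_right _ _) }
  have hext : ∀ {u : ℝ → E}, BddMeasOn u t₀ T →
      Measurable fun t => u (Set.projIcc t₀ T hTt t) :=
    fun hu => hu.1.comp continuous_projIcc.measurable
  have hproj : ∀ {t : ℝ}, t ∈ Set.Icc t₀ T → ((Set.projIcc t₀ T hTt t : ℝ)) = t :=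
    fun ht => by rw [Set.projIcc_of_mem hTt ht]
  set w : ℝ → E := fun t => S (t - t₀) y + z (Set.projIcc t₀ T hTt t) with hw
  have hwm : StronglyMeasurable w :=
    (hSmeas.comp ((measurable_id.sub_const t₀).prodMk
      measurable_const)).stronglyMeasurable_of_standardBorelSpace.add
        (hext hz).stronglyMeasurable_of_standardBorelSpace
  obtain ⟨M, hM⟩ := hz.2
  have hwR : ∀ t ∈ Set.Icc t₀ T, ‖w t‖ ≤ C_A * ‖y‖ + M := fun t ht =>
    norm_add_le_of_le (hSle _ (hmem le_rfl ht.1 ht.2) y) (hM _ (Set.projIcc t₀ T hTt t).2)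
  constructor
  · obtain ⟨U, hUm, hU⟩ := hf.exists_eq hTt hwm hwR
    refine ⟨U, ⟨hUm.comp measurable_subtype_coe,
      C_A * ‖y‖ + M + C_A * Bsup * (T - t₀), fun t ht => ?_⟩, fun t ht => ?_⟩
    · rw [hU t ht]
      exact norm_add_le_of_le (hwR t ht) (hf.norm_integral_le U ht)
    · rw [hU t ht, hw, add_right_comm]
      simp only [hproj ht]
  · intro Y₁ Y₂ hY₁ hs₁ hY₂ hs₂ t ht
    have hsol : ∀ {Y : ℝ → E}, IsMildSolution S B t₀ T y z Y → ∀ r ∈ Set.Icc t₀ T,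
        Y (Set.projIcc t₀ T hTt r) =
          w r + ∫ s in t₀..r, S (r - s) (B s (Y (Set.projIcc t₀ T hTt s))) := by
      intro Y hs r hr
      have hint : ∫ s in t₀..r, S (r - s) (B s (Y (Set.projIcc t₀ T hTt s))) =
          ∫ s in t₀..r, S (r - s) (B s (Y s)) := by
        refine intervalIntegral.integral_congr fun s hsr => ?_
        rw [Set.uIcc_of_le hr.1] at hsr
        simp only [hproj ⟨hsr.1, hsr.2.trans hr.2⟩]
      rw [hint, hproj hr, hs r hr, hw, add_right_comm]
      simp only [hproj hr]
    have h := hf.eqOn_of_eq (hext hY₁) (hext hY₂) (hsol hs₁) (hsol hs₂) ht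
    simpa only [hproj ht] using h
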